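/- Let q be a prime power, n, k > 0 integers, and R = A/t^kA. Let Ω ⊆ S^{n−1}(R) be nonempty with J = |Ω|, and let m be the least positive integer with mJ ≥ q^{kn}/2. Then there exist invertible matrices R_1,…,R_m ∈ GL_n(R) such that |⋃_{i=1}^m R_i(Ω)| ≥ c₀·|S^{n−1}(R)|, where c₀ = 1 − e^{−1/2}. -/

import Mathlib

open scoped Classical
noncomputable section

/-- `Rk Fq k` is the quotient ring `R = A/t^k A` where `A = 𝔽_q[[t]]`. -/
abbrev Rk (Fq : Type) [Field Fq] (k : ℕ) : Type :=
  PowerSeries Fq ⧸ Ideal.span {(PowerSeries.X : PowerSeries Fq) ^ k}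

/-- The image of `t` in `R = A/t^k A`. -/
def tbar (Fq : Type) [Field Fq] (k : ℕ) : Rk Fq k :=
  Ideal.Quotient.mk _ PowerSeries.X

/-- The set `S^{n-1}(R) = R^n ∖ (tR)^n` of primitive vectors of `R^n`. -/
def primSet (Fq : Type) [Field Fq] (n k : ℕ) : Set (Fin n → Rk Fq k) :=
  {w | ¬ ∀ i, ∃ r : Rk Fq k, w i = tbar Fq k * r}

/-- The line in `R^n` through `b` in the direction of `w`. -/
def rline {Fq : Type} [Field Fq] {n k : ℕ} (b w : Fin n → Rk Fq k) :
    Set (Fin n → Rk Fq k) :=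
  {v | ∃ r : Rk Fq k, v = fun i => b i + r * w i}

/-- The discrete Kakeya maximal function
`φ*(w) = sup_{ℓ ∥ w} q^{-k} Σ_{v ∈ ℓ} |φ(v)|`. -/
def maxFn (Fq : Type) [Field Fq] [Fintype Fq] {n k : ℕ}
    (φ : (Fin n → Rk Fq k) → ℝ) (w : Fin n → Rk Fq k) : ℝ :=
  ⨆ b : Fin n → Rk Fq k,
    ((Fintype.card Fq : ℝ) ^ k)⁻¹ * ∑ᶠ v ∈ rline b w, |φ v|

section Averaging

variable {G X : Type*} [Group G] [Fintype G] [DecidableEq X] [MulAction G X]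

/-- For a group acting transitively on an invariant finite set `S`, the fibres of the orbit maps
all have cardinality `|G| / |S|`. -/
theorem card_transporter_mul_card (S : Finset X)
    (hinv : ∀ (g : G), ∀ x ∈ S, g • x ∈ S)
    (htrans : ∀ x ∈ S, ∀ y ∈ S, ∃ g : G, g • x = y)
    {x y : X} (hx : x ∈ S) (hy : y ∈ S) :
    (Finset.univ.filter fun g : G => g • x = y).card * S.card = Fintype.card G := by
  have hconst : ∀ z ∈ S, (Finset.univ.filter fun g : G => g • x = z).card
      = (Finset.univ.filter fun g : G => g • x = y).card := by
    intro z hz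
    obtain ⟨h, rfl⟩ := htrans z hz y hy
    refine Finset.card_bij (fun g _ => h * g) ?_ ?_ ?_
    · intro g hg
      simp only [Finset.mem_filter, Finset.mem_univ, true_and] at hg ⊢
      rw [mul_smul, hg]
    · intro a _ b _ hab
      exact mul_left_cancel hab
    · intro b hb
      simp only [Finset.mem_filter, Finset.mem_univ, true_and] at hb
      exact ⟨h⁻¹ * b, by simp [mul_smul, hb], by simp⟩
  have hsum := Finset.card_eq_sum_card_fiberwise (s := (Finset.univ : Finset G)) (t := S)
    (f := fun g => g • x) (fun g _ => hinv g x hx)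
  rw [Finset.sum_congr rfl hconst, Finset.sum_const, smul_eq_mul, Finset.card_univ] at hsum
  rw [hsum, mul_comm]

/-- The average size of the intersection of `U` with a random translate of `Ω`. -/
theorem sum_card_inter_smul_mul_card (S U Ω : Finset X) (hU : U ⊆ S) (hΩ : Ω ⊆ S)
    (hinv : ∀ (g : G), ∀ x ∈ S, g • x ∈ S)
    (htrans : ∀ x ∈ S, ∀ y ∈ S, ∃ g : G, g • x = y) :
    (∑ g : G, (U ∩ Ω.image fun x => g • x).card) * S.card
      = Fintype.card G * (U.card * Ω.card) := by
  have hinter : ∀ g : G, (U ∩ Ω.image fun x => g • x).card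
      = ∑ u ∈ U, ∑ x ∈ Ω, if g • x = u then 1 else 0 := by
    intro g
    rw [Finset.sum_comm, ← Finset.filter_mem_eq_inter.symm.trans (Finset.inter_comm _ _),
      ← Finset.filter_mem_eq_inter, Finset.filter_image,
      Finset.card_image_of_injective _ (MulAction.injective g), Finset.card_filter]
    exact Finset.sum_congr rfl fun x _ => by simp
  simp_rw [hinter]
  rw [Finset.sum_comm, Finset.sum_mul]
  have hterm : ∀ u ∈ U, (∑ g : G, ∑ x ∈ Ω, if g • x = u then 1 else 0) * S.card
      = Ω.card * Fintype.card G := by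
    intro u hu
    rw [Finset.sum_comm, Finset.sum_mul, ← smul_eq_mul, ← Finset.sum_const]
    refine Finset.sum_congr rfl fun x hx => ?_
    rw [← Finset.card_filter]
    exact card_transporter_mul_card S hinv htrans (hΩ hx) (hU hu)
  rw [Finset.sum_congr rfl hterm, Finset.sum_const, smul_eq_mul]
  ring

/-- Some translate of `Ω` covers at least the average proportion of `U`. -/
theorem exists_card_sdiff_smul_le (S U Ω : Finset X) (hS : S.Nonempty) (hU : U ⊆ S)
    (hΩ : Ω ⊆ S) (hinv : ∀ (g : G), ∀ x ∈ S, g • x ∈ S)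
    (htrans : ∀ x ∈ S, ∀ y ∈ S, ∃ g : G, g • x = y) :
    ∃ g : G, ((U \ Ω.image fun x => g • x).card : ℝ)
      ≤ (1 - (Ω.card : ℝ) / S.card) * U.card := by
  have hS0 : (0 : ℝ) < S.card := by exact_mod_cast hS.card_pos
  have havg : ∑ _g : G, (U.card : ℝ) * Ω.card / S.card
      ≤ ∑ g : G, ((U ∩ Ω.image fun x => g • x).card : ℝ) := by
    have h := sum_card_inter_smul_mul_card S U Ω hU hΩ hinv htrans
    have h' : (∑ g : G, ((U ∩ Ω.image fun x => g • x).card : ℝ)) * S.card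
      = Fintype.card G * (U.card * Ω.card) := by exact_mod_cast h
    rw [Finset.sum_const, nsmul_eq_mul, Finset.card_univ, ← mul_div_assoc, ← h',
      mul_div_cancel_right₀ _ hS0.ne']
  obtain ⟨g, -, hg⟩ := Finset.exists_le_of_sum_le Finset.univ_nonempty havg
  refine ⟨g, ?_⟩
  have hsplit : ((U \ Ω.image fun x => g • x).card : ℝ)
      + (U ∩ Ω.image fun x => g • x).card = U.card := by
    exact_mod_cast Finset.card_sdiff_add_card_inter U _
  have : (1 - (Ω.card : ℝ) / S.card) * U.card = U.card - U.card * Ω.card / S.card := by ring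
  linarith

/-- Greedy covering of an invariant transitive set by `m` translates of `Ω`. -/
theorem exists_card_sdiff_biUnion_smul_le (S Ω : Finset X) (hS : S.Nonempty)
    (hΩ : Ω ⊆ S) (hinv : ∀ (g : G), ∀ x ∈ S, g • x ∈ S)
    (htrans : ∀ x ∈ S, ∀ y ∈ S, ∃ g : G, g • x = y) (m : ℕ) :
    ∃ M : Fin m → G,
      ((S \ Finset.univ.biUnion fun i => Ω.image fun x => M i • x).card : ℝ)
        ≤ (1 - (Ω.card : ℝ) / S.card) ^ m * S.card := by
  induction m with
  | zero => exact ⟨Fin.elim0, by simp⟩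
  | succ m ih =>
    obtain ⟨M, hM⟩ := ih
    obtain ⟨g, hg⟩ := exists_card_sdiff_smul_le S _ Ω hS
      (Finset.sdiff_subset (s := S)
        (t := Finset.univ.biUnion fun i => Ω.image fun x => M i • x)) hΩ hinv htrans
    refine ⟨Fin.cons g M, ?_⟩
    have hset : (S \ Finset.univ.biUnion fun i =>
          Ω.image fun x => (Fin.cons g M : Fin (m + 1) → G) i • x)
        = (S \ Finset.univ.biUnion fun i => Ω.image fun x => M i • x)
            \ Ω.image fun x => g • x := by
      ext y
      simp only [Finset.mem_sdiff, Finset.mem_biUnion, Finset.mem_univ, true_and,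
        Fin.exists_fin_succ, Fin.cons_zero, Fin.cons_succ]
      tauto
    have hle : (0 : ℝ) ≤ 1 - (Ω.card : ℝ) / S.card := by
      rw [sub_nonneg]
      exact div_le_one_of_le₀ (by exact_mod_cast Finset.card_le_card hΩ) (Nat.cast_nonneg _)
    rw [hset, pow_succ', mul_assoc]
    exact hg.trans (mul_le_mul_of_nonneg_left hM hle)

end Averaging

section Primitive

variable {Fq : Type} [Field Fq] {n k : ℕ}

/-- The power series with prescribed coefficients in degrees `< k`, modulo `t^k`. -/
def coeffsToRk (Fq : Type) [Field Fq] (k : ℕ) (c : Fin k → Fq) : Rk Fq k :=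
  Ideal.Quotient.mk _ (PowerSeries.mk fun j => if h : j < k then c ⟨j, h⟩ else 0)

theorem coeffsToRk_surjective : Function.Surjective (coeffsToRk Fq k) := by
  intro r
  obtain ⟨f, rfl⟩ := Ideal.Quotient.mk_surjective r
  refine ⟨fun i => PowerSeries.coeff i f, ?_⟩
  rw [coeffsToRk, Ideal.Quotient.eq, Ideal.mem_span_singleton, PowerSeries.X_pow_dvd_iff]
  intro j hj
  simp [hj]

theorem finite_Rk [Finite Fq] : Finite (Rk Fq k) :=
  Finite.of_surjective _ coeffsToRk_surjective

theorem card_Rk_le [Fintype Fq] : Nat.card (Rk Fq k) ≤ Fintype.card Fq ^ k := by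
  refine (Nat.card_le_card_of_surjective _ (coeffsToRk_surjective (Fq := Fq) (k := k))).trans ?_
  simp

theorem isUnit_of_not_tbar_dvd {r : Rk Fq k} (hr : ¬ ∃ s, r = tbar Fq k * s) : IsUnit r := by
  obtain ⟨f, rfl⟩ := Ideal.Quotient.mk_surjective r
  refine IsUnit.map _ (PowerSeries.isUnit_iff_constantCoeff.2 (isUnit_iff_ne_zero.2 ?_))
  intro h0
  obtain ⟨g, rfl⟩ := PowerSeries.X_dvd_iff.2 h0
  exact hr ⟨Ideal.Quotient.mk _ g, map_mul _ _ _⟩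

theorem exists_isUnit_of_mem_primSet {w : Fin n → Rk Fq k} (hw : w ∈ primSet Fq n k) :
    ∃ i, IsUnit (w i) := by
  obtain ⟨i, hi⟩ := not_forall.1 hw
  exact ⟨i, isUnit_of_not_tbar_dvd hi⟩

/-- `GL_n(R)` acts on `R^n` by matrix-vector multiplication. -/
abbrev glMulVecAction (ι R : Type*) [Fintype ι] [DecidableEq ι] [CommRing R] :
    MulAction (GL ι R) (ι → R) where
  smul g v := (g : Matrix ι ι R).mulVec v
  one_smul v := Matrix.one_mulVec v
  mul_smul g h v := (Matrix.mulVec_mulVec v (g : Matrix ι ι R) (h : Matrix ι ι R)).symm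

/-- A vector with a unit coordinate is the image of the matching basis vector under `GL_n`. -/
theorem exists_gl_mulVec_single {ι R : Type*} [Fintype ι] [DecidableEq ι] [CommRing R]
    {w : ι → R} {i : ι} (hi : IsUnit (w i)) :
    ∃ g : GL ι R, (g : Matrix ι ι R).mulVec (Pi.single i 1) = w := by
  have hdet : ((1 : Matrix ι ι R).updateCol i w).det = w i := by
    rw [← Matrix.cramer_apply, Matrix.cramer_one, Module.End.one_apply]
  refine ⟨Matrix.GeneralLinearGroup.mk'' ((1 : Matrix ι ι R).updateCol i w) (hdet ▸ hi), ?_⟩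
  ext j
  change ((1 : Matrix ι ι R).updateCol i w).mulVec (Pi.single i 1) j = w j
  simp

theorem exists_gl_mulVec_eq {ι R : Type*} [Fintype ι] [DecidableEq ι] [CommRing R]
    {v w : ι → R} (hv : ∃ i, IsUnit (v i)) (hw : ∃ i, IsUnit (w i)) :
    ∃ g : GL ι R, (g : Matrix ι ι R).mulVec v = w := by
  let := glMulVecAction ι R
  have key : ∀ u : ι → R, (∃ i, IsUnit (u i)) → ∃ g : GL ι R, g • (1 : ι → R) = u := by
    rintro u ⟨i, hi⟩
    obtain ⟨g, hg⟩ := exists_gl_mulVec_single hi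
    obtain ⟨h, hh⟩ := exists_gl_mulVec_single (w := (1 : ι → R)) (i := i) (by simp)
    change g • (Pi.single i 1 : ι → R) = _ at hg
    change h • (Pi.single i 1 : ι → R) = _ at hh
    exact ⟨g * h⁻¹, by rw [mul_smul, ← hh, inv_smul_smul, hg]⟩
  obtain ⟨g, rfl⟩ := key v hv
  obtain ⟨h, rfl⟩ := key w hw
  exact ⟨h * g⁻¹, by change (h * g⁻¹) • g • (1 : ι → R) = _; rw [mul_smul, inv_smul_smul]⟩

theorem mulVec_mem_primSet (g : GL (Fin n) (Rk Fq k)) {w : Fin n → Rk Fq k}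
    (hw : w ∈ primSet Fq n k) :
    (g : Matrix (Fin n) (Fin n) (Rk Fq k)).mulVec w ∈ primSet Fq n k := by
  let := glMulVecAction (Fin n) (Rk Fq k)
  intro h
  choose r hr using h
  refine hw fun i =>
    ⟨((g⁻¹ : GL (Fin n) (Rk Fq k)) : Matrix (Fin n) (Fin n) (Rk Fq k)).mulVec r i, ?_⟩
  have h1 : g • w = tbar Fq k • r := funext hr
  have h2 : w = g⁻¹ • (tbar Fq k • r) := by rw [← h1, inv_smul_smul]
  rw [h2]
  exact congrFun (Matrix.mulVec_smul _ _ _) i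

theorem ncard_primSet_le [Fintype Fq] :
    (primSet Fq n k).ncard ≤ Fintype.card Fq ^ (k * n) := by
  have := finite_Rk (Fq := Fq) (k := k)
  calc (primSet Fq n k).ncard ≤ Nat.card (Fin n → Rk Fq k) := Set.ncard_le_card _
    _ = Nat.card (Rk Fq k) ^ n := by simp [Nat.card_fun]
    _ ≤ (Fintype.card Fq ^ k) ^ n := Nat.pow_le_pow_left card_Rk_le n
    _ = _ := (pow_mul _ _ _).symm

end Primitive

/-- **Random rotation trick.** If `Ω ⊆ S^{n-1}(R)` is nonempty with `J = |Ω|`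
and `m` is the least positive integer with `mJ ≥ q^{kn}/2`, then there are
invertible matrices `R_1, …, R_m ∈ GL_n(R)` with
`|⋃_i R_i(Ω)| ≥ (1 - e^{-1/2})·|S^{n-1}(R)|`. -/
theorem random_rotation_trick
    (Fq : Type) [Field Fq] [Fintype Fq] (n k : ℕ) (hn : 0 < n) (hk : 0 < k)
    (Ω : Set (Fin n → Rk Fq k)) (hne : Ω.Nonempty) (hΩ : Ω ⊆ primSet Fq n k)
    (m : ℕ) (hm : 0 < m)
    (hge : (Fintype.card Fq : ℝ) ^ (k * n) / 2 ≤ (m : ℝ) * (Ω.ncard : ℝ))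
    (hmin : ∀ m' : ℕ, 0 < m' →
      (Fintype.card Fq : ℝ) ^ (k * n) / 2 ≤ (m' : ℝ) * (Ω.ncard : ℝ) → m ≤ m') :
    ∃ M : Fin m → GL (Fin n) (Rk Fq k),
      (1 - Real.exp (-(1 / 2))) * ((primSet Fq n k).ncard : ℝ)
        ≤ ((⋃ i : Fin m,
            (fun v => Matrix.mulVec (M i : Matrix (Fin n) (Fin n) (Rk Fq k)) v) '' Ω).ncard : ℝ) := by
  have := finite_Rk (Fq := Fq) (k := k)
  have := Fintype.ofFinite (Rk Fq k)
  have : Fintype (GL (Fin n) (Rk Fq k)) := Fintype.ofFinite _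
  let := glMulVecAction (Fin n) (Rk Fq k)
  have hS : (primSet Fq n k).toFinset.Nonempty := Set.toFinset_nonempty.2 (hne.mono hΩ)
  obtain ⟨M, hM⟩ := exists_card_sdiff_biUnion_smul_le (G := GL (Fin n) (Rk Fq k))
    (primSet Fq n k).toFinset Ω.toFinset hS (Set.toFinset_subset_toFinset.2 hΩ)
    (fun g x hx => Set.mem_toFinset.2 (mulVec_mem_primSet g (Set.mem_toFinset.1 hx)))
    (fun x hx y hy => exists_gl_mulVec_eq
      (exists_isUnit_of_mem_primSet (Set.mem_toFinset.1 hx))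
      (exists_isUnit_of_mem_primSet (Set.mem_toFinset.1 hy))) m
  refine ⟨M, ?_⟩
  have hunion : (⋃ i : Fin m,
      (fun v => Matrix.mulVec (M i : Matrix (Fin n) (Fin n) (Rk Fq k)) v) '' Ω)
      = ((Finset.univ.biUnion fun i => Ω.toFinset.image fun x => M i • x :
          Finset (Fin n → Rk Fq k)) : Set (Fin n → Rk Fq k)) := by
    simp only [Finset.coe_biUnion, Finset.coe_image, Set.coe_toFinset, Finset.coe_univ,
      Set.mem_univ, Set.iUnion_true]
    rfl
  rw [hunion, Set.ncard_coe_finset, Set.ncard_eq_toFinset_card']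
  have hcard := ncard_primSet_le (Fq := Fq) (n := n) (k := k)
  rw [Set.ncard_eq_toFinset_card'] at hcard hge
  have hsub := Finset.card_le_card (Set.toFinset_subset_toFinset.2 hΩ)
  generalize (Finset.univ.biUnion fun i => Ω.toFinset.image fun x => M i • x) = T at hM ⊢
  generalize (primSet Fq n k).toFinset = S at *
  generalize Ω.toFinset = W at *
  have hS0 : (0 : ℝ) < S.card := by exact_mod_cast hS.card_pos
  have hcard' : (S.card : ℝ) ≤ (Fintype.card Fq : ℝ) ^ (k * n) := by exact_mod_cast hcard
  have hsplit : (S.card : ℝ) ≤ (S \ T).card + T.card := by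
    exact_mod_cast Finset.card_le_card_sdiff_add_card
  have hratio : (W.card : ℝ) / S.card ≤ 1 := by
    rw [div_le_one hS0]
    exact_mod_cast hsub
  have hpow : (1 - (W.card : ℝ) / S.card) ^ m ≤ Real.exp (-(1 / 2)) := by
    calc (1 - (W.card : ℝ) / S.card) ^ m
        ≤ Real.exp (-((W.card : ℝ) / S.card)) ^ m :=
          pow_le_pow_left₀ (sub_nonneg.2 hratio) (Real.one_sub_le_exp_neg _) m
      _ = Real.exp (-(m * W.card / S.card)) := by
          rw [← Real.exp_nat_mul]; congr 1; ring
      _ ≤ Real.exp (-(1 / 2)) := by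
          rw [Real.exp_le_exp, neg_le_neg_iff, le_div_iff₀ hS0]
          linarith
  have := hM.trans (mul_le_mul_of_nonneg_right hpow hS0.le)
  linarith
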